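/- Under the constrained deterministic setup with variational coherence, the reciprocity assumption, and the delay/step-size assumption, the global state variable of DAGD converges to the solution set of the optimization problem: dist(x_n, 𝒳*) → 0 as n → ∞. -/

import Mathlib

open scoped RealInnerProductSpace

noncomputable section

/-- The energy of a dual point `y` with respect to a fixed solution `x*`:
`E_{x*}(y) = ‖x*‖² − ‖Π(y)‖² + 2⟨y, Π(y) − x*⟩`. -/
def Eaux {d : ℕ} (proj : EuclideanSpace ℝ (Fin d) → EuclideanSpace ℝ (Fin d))
    (xstar y : EuclideanSpace ℝ (Fin d)) : ℝ :=
  ‖xstar‖ ^ 2 - ‖proj y‖ ^ 2 + 2 * ⟪y, proj y - xstar⟫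

/-- The energy function `E(y) = inf_{x* ∈ 𝒳*} E_{x*}(y)`. -/
def energy {d : ℕ} (proj : EuclideanSpace ℝ (Fin d) → EuclideanSpace ℝ (Fin d))
    (Xstar : Set (EuclideanSpace ℝ (Fin d))) (y : EuclideanSpace ℝ (Fin d)) : ℝ :=
  ⨅ xs : Xstar, Eaux proj (xs : EuclideanSpace ℝ (Fin d)) y

/-- Delay/step-size assumption (Assumption 2 of the paper):
(i) bounded delays with square-summable, non-summable step-sizes;
(ii) sublinearly growing delays with `α n = 1/n`;
(iii) linearly growing delays with `α n = 1/(n log n)`;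
(iv) polynomially growing delays with `α n = 1/(n log n · log log n)`. -/
def DelayStep (s : ℕ → ℕ) (α : ℕ → ℝ) : Prop :=
  (∃ D : ℕ, (∀ n, n - s n ≤ D) ∧ Summable (fun n => (α n) ^ 2) ∧ ¬ Summable α) ∨
  (∃ K : ℝ, 0 < K ∧ ∃ p : ℝ, 0 < p ∧ p < 1 ∧
    (∀ n : ℕ, (n : ℝ) - (s n : ℝ) ≤ K * (s n : ℝ) ^ p) ∧
    (∀ n : ℕ, 1 ≤ n → α n = 1 / n)) ∨
  (∃ K : ℝ, 0 < K ∧ (∀ n : ℕ, (n : ℝ) - (s n : ℝ) ≤ K * (s n : ℝ)) ∧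
    (∀ n : ℕ, 2 ≤ n → α n = 1 / (n * Real.log n))) ∨
  (∃ K : ℝ, 0 < K ∧ ∃ q : ℝ, 1 ≤ q ∧
    (∀ n : ℕ, (n : ℝ) - (s n : ℝ) ≤ K * (s n : ℝ) ^ q) ∧
    (∀ n : ℕ, 3 ≤ n → α n = 1 / (n * Real.log n * Real.log (Real.log n))))

/-! ### Real inequalities and summability -/

lemma log_sub_log_le_sub_div {a b : ℝ} (ha : 0 < a) (hb : 0 < b) :
    Real.log b - Real.log a ≤ (b - a) / a := by
  rw [← Real.log_div hb.ne' ha.ne', sub_div, div_self ha.ne']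
  exact Real.log_le_sub_one_of_pos (div_pos hb ha)

lemma sub_div_le_log_sub_log {a b : ℝ} (ha : 0 < a) (hb : 0 < b) :
    (b - a) / b ≤ Real.log b - Real.log a := by
  have h := log_sub_log_le_sub_div hb ha
  have e : (b - a) / b = -((a - b) / b) := by ring
  linarith

lemma summable_sub_succ_of_antitone {b : ℕ → ℝ} (hb : Antitone b) (h0 : ∀ n, 0 ≤ b n) :
    Summable fun n => b n - b (n + 1) := by
  refine summable_of_sum_range_le (c := b 0) (fun n => sub_nonneg.2 (hb n.le_succ)) fun n => ?_
  rw [Finset.sum_range_sub']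
  linarith [h0 n]

lemma not_summable_of_sub_le {u v : ℕ → ℝ} (hv : ∀ n, 0 ≤ v n) (N : ℕ)
    (hu : Filter.Tendsto u Filter.atTop Filter.atTop)
    (h : ∀ n, N ≤ n → u (n + 1) - u n ≤ v n) : ¬ Summable v := by
  intro hs
  obtain ⟨n, hn, hnN⟩ := ((hu.eventually_gt_atTop (u N + ∑' i, v i)).and
    (Filter.eventually_ge_atTop N)).exists
  have h1 : u n - u N ≤ ∑ i ∈ Finset.Ico N n, v i := by
    rw [← Finset.sum_Ico_sub u hnN]
    exact Finset.sum_le_sum fun i hi => h i (Finset.mem_Ico.1 hi).1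
  linarith [hs.sum_le_tsum (Finset.Ico N n) fun i _ => hv i]

/-- If `∑ β φ` and `∑ β²` converge, `∑ β` diverges and the increments of `φ ≥ 0` are `O(β)`,
then `φ` tends to zero. -/
lemma tendsto_zero_of_summable_mul {β φ : ℕ → ℝ} {C : ℝ} (hβ : ∀ n, 0 ≤ β n)
    (hφ : ∀ n, 0 ≤ φ n) (hβ2 : Summable fun n => β n ^ 2) (hdiv : ¬ Summable β)
    (hsum : Summable fun n => β n * φ n) (hinc : ∀ n, |φ (n + 1) - φ n| ≤ C * β n) :
    Filter.Tendsto φ Filter.atTop (nhds 0) := by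
  have hbound : ∀ n, dist (φ n ^ 2) (φ n.succ ^ 2) ≤
      2 * C * (β n * φ n) + C ^ 2 * β n ^ 2 := by
    intro n
    have hfac : φ n ^ 2 - φ (n + 1) ^ 2 = -((φ (n + 1) - φ n) * (φ (n + 1) + φ n)) := by ring
    have hplus : 0 ≤ φ (n + 1) + φ n := add_nonneg (hφ _) (hφ _)
    rw [Real.dist_eq, Nat.succ_eq_add_one, hfac, abs_neg, abs_mul, abs_of_nonneg hplus]
    have hle : φ (n + 1) + φ n ≤ 2 * φ n + C * β n := by
      linarith [(le_abs_self _).trans (hinc n)]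
    calc |φ (n + 1) - φ n| * (φ (n + 1) + φ n)
        ≤ (C * β n) * (2 * φ n + C * β n) :=
          mul_le_mul (hinc n) hle hplus ((abs_nonneg _).trans (hinc n))
      _ = _ := by ring
  obtain ⟨l, hl⟩ := cauchySeq_tendsto_of_complete (cauchySeq_of_dist_le_of_summable _ hbound
    ((hsum.mul_left _).add (hβ2.mul_left _)))
  have hlim : Filter.Tendsto φ Filter.atTop (nhds √l) := by
    simpa [Real.sqrt_sq (hφ _)] using hl.sqrt
  rcases (Real.sqrt_nonneg l).eq_or_lt with h0 | hpos
  · rwa [← h0] at hlim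
  · refine absurd ?_ hdiv
    refine Summable.of_norm_bounded_eventually_nat (hsum.mul_left (√l / 2)⁻¹) ?_
    filter_upwards [hlim.eventually (lt_mem_nhds (half_lt_self hpos))] with n hn
    rw [Real.norm_of_nonneg (hβ n), ← div_eq_inv_mul, le_div_iff₀ (half_pos hpos)]
    exact mul_le_mul_of_nonneg_left hn.le (hβ n)

/-! ### Consequences of the delay/step-size assumption -/

/-- A potential `T` that increases by at least a multiple of `β n * T (n + 1)` at step `n`, but only
by a bounded amount over each delay window, makes the squares and the delay-weighted products
of the steps `β` summable. -/
lemma summable_of_potential {β T : ℕ → ℝ} {s : ℕ → ℕ} {M c : ℝ} {N : ℕ}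
    (hβ : ∀ n, 0 ≤ β n) (hM : 0 ≤ M) (hc : 0 ≤ c)
    (hTpos : ∀ n, N ≤ n → 0 < T n) (hTmono : ∀ n, N ≤ n → T n ≤ T (n + 1))
    (hβT : ∀ n, N ≤ n → β n ≤ M * ((T (n + 1) - T n) / T (n + 1)))
    (hs : ∀ n, s n ≤ n)
    (hwin : ∀ᶠ n in Filter.atTop, N ≤ s n ∧ T (n + 1) ≤ T (s n) + c) :
    Summable (fun n => β n ^ 2) ∧
      Summable fun n => β n * ∑ r ∈ Finset.Ico (s n) n, β r := by
  have hmono : ∀ m n, N ≤ m → m ≤ n → T m ≤ T n := by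
    intro m n hm hmn
    induction n, hmn using Nat.le_induction with
    | base => exact le_rfl
    | succ k hk ih => exact ih.trans (hTmono k (hm.trans hk))
  have htel : Summable fun n => (T n)⁻¹ - (T (n + 1))⁻¹ := by
    rw [← summable_nat_add_iff N]
    have := summable_sub_succ_of_antitone (b := fun n => (T (n + N))⁻¹)
      (antitone_nat_of_succ_le fun n => by
        have := hTmono (n + N) (by omega)
        rw [add_right_comm]
        exact inv_anti₀ (hTpos _ (by omega)) this)
      (fun n => (inv_pos.2 (hTpos _ (by omega))).le)
    refine this.congr fun n => ?_
    rw [add_right_comm]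
  have htel_ge : ∀ n, N ≤ n → (T (n + 1) - T n) / T (n + 1) * (T (n + 1))⁻¹ ≤
      (T n)⁻¹ - (T (n + 1))⁻¹ := by
    intro n hn
    have h1 := hTpos n hn
    have h2 := hTpos (n + 1) (by omega)
    rw [inv_sub_inv h1.ne' h2.ne', div_mul_eq_mul_div, ← div_eq_mul_inv, div_div]
    exact div_le_div_of_nonneg_left (sub_nonneg.2 (hTmono n hn)) (mul_pos h1 h2)
      (mul_le_mul_of_nonneg_right (hTmono n hn) h2.le)
  have key : ∀ (e : ℕ → ℝ) (A : ℝ), (∀ n, 0 ≤ e n) →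
      (∀ᶠ n in Filter.atTop, e n ≤ A * (T (n + 1))⁻¹) →
      Summable fun n => β n * e n := by
    intro e A he0 he
    refine Summable.of_norm_bounded_eventually_nat (htel.mul_left (M * A)) ?_
    filter_upwards [he, Filter.eventually_ge_atTop N] with n hn hnN
    have hT := hTpos (n + 1) (by omega)
    have hA : 0 ≤ A := by
      have := (he0 n).trans hn
      rwa [mul_nonneg_iff_of_pos_right (inv_pos.2 hT)] at this
    rw [Real.norm_of_nonneg (mul_nonneg (hβ n) (he0 n))]
    calc β n * e n ≤ (M * ((T (n + 1) - T n) / T (n + 1))) * (A * (T (n + 1))⁻¹) :=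
          mul_le_mul (hβT n hnN) hn (he0 n) ((hβ n).trans (hβT n hnN))
      _ = M * A * ((T (n + 1) - T n) / T (n + 1) * (T (n + 1))⁻¹) := by ring
      _ ≤ _ := mul_le_mul_of_nonneg_left (htel_ge n hnN) (mul_nonneg hM hA)
  constructor
  · simp_rw [sq]
    refine key β (M * c) hβ ?_
    filter_upwards [hwin] with n hn
    have hnN := hn.1.trans (hs n)
    refine (hβT n hnN).trans ?_
    rw [mul_assoc, ← div_eq_mul_inv]
    have hT := hTpos (n + 1) (by omega)
    have := hmono _ _ hn.1 (hs n)
    gcongr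
    linarith [hn.2]
  · refine key _ (M * c * (1 + c / T N)) (fun n => Finset.sum_nonneg fun r _ => hβ r) ?_
    filter_upwards [hwin] with n hn
    have hnN := hn.1.trans (hs n)
    have hTN := hTpos N le_rfl
    have hTs := hTpos (s n) hn.1
    have hT := hTpos (n + 1) (by omega)
    have hsum : ∑ r ∈ Finset.Ico (s n) n, β r ≤ M * c / T (s n) := by
      calc ∑ r ∈ Finset.Ico (s n) n, β r
          ≤ ∑ r ∈ Finset.Ico (s n) n, M / T (s n) * (T (r + 1) - T r) := by
            refine Finset.sum_le_sum fun r hr => ?_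
            have hr' := (Finset.mem_Ico.1 hr).1
            have hrN := hn.1.trans hr'
            refine (hβT r hrN).trans ?_
            rw [div_mul_eq_mul_div, ← mul_div_assoc]
            have h1 : 0 ≤ T (r + 1) - T r := sub_nonneg.2 (hTmono r hrN)
            have h2 := hmono _ _ hn.1 (hr'.trans r.le_succ)
            exact div_le_div_of_nonneg_left (mul_nonneg hM h1) hTs h2
        _ = M / T (s n) * (T n - T (s n)) := by
            rw [← Finset.mul_sum, Finset.sum_Ico_sub _ (hs n)]
        _ ≤ M / T (s n) * c := by
            have := hTmono n hnN
            gcongr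
            linarith [hn.2]
        _ = _ := by ring
    have hratio : T (n + 1) ≤ (1 + c / T N) * T (s n) := by
      have h3 : c ≤ c / T N * T (s n) := by
        rw [div_mul_eq_mul_div, le_div_iff₀ hTN]
        exact mul_le_mul_of_nonneg_left (hmono _ _ le_rfl hn.1) hc
      linarith [hn.2]
    refine hsum.trans ?_
    rw [← div_eq_mul_inv, div_le_div_iff₀ hTs hT, mul_assoc (M * c)]
    exact mul_le_mul_of_nonneg_left hratio (mul_nonneg hM hc)

lemma tendsto_atTop_of_delay_le_rpow {s : ℕ → ℕ} {K q : ℝ} (hK : 0 ≤ K) (hq : 0 ≤ q)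
    (h : ∀ n : ℕ, (n : ℝ) - s n ≤ K * (s n : ℝ) ^ q) :
    Filter.Tendsto s Filter.atTop Filter.atTop := by
  refine Filter.tendsto_atTop.2 fun N => ?_
  filter_upwards [tendsto_natCast_atTop_atTop.eventually_gt_atTop (N + K * (N : ℝ) ^ q)] with n hn
  by_contra! hlt
  have h1 : (s n : ℝ) ≤ N := by exact_mod_cast hlt.le
  have h2 : (s n : ℝ) ^ q ≤ (N : ℝ) ^ q := Real.rpow_le_rpow (Nat.cast_nonneg _) h1 hq
  have h3 := mul_le_mul_of_nonneg_left h2 hK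
  linarith [h n]

lemma succ_le_of_delay_le_rpow {n m : ℕ} {K q : ℝ} (hq : 1 ≤ q) (hm : 1 ≤ m)
    (h : (n : ℝ) - m ≤ K * (m : ℝ) ^ q) : (n : ℝ) + 1 ≤ (K + 2) * (m : ℝ) ^ q := by
  have hm' : (1 : ℝ) ≤ m := by exact_mod_cast hm
  have h1 : (m : ℝ) ≤ (m : ℝ) ^ q := by
    simpa using Real.rpow_le_rpow_of_exponent_le hm' hq
  linarith

/-- The step-size properties on which the convergence proof rests. -/
def AdmissibleSteps (β : ℕ → ℝ) (s : ℕ → ℕ) : Prop :=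
  Summable (fun n => β n ^ 2) ∧ ¬ Summable β ∧
    Summable fun n => β n * ∑ r ∈ Finset.Ico (s n) n, β r

lemma admissibleSteps_of_bounded_delay {β : ℕ → ℝ} {s : ℕ → ℕ} {D : ℕ} (hβ : ∀ n, 0 ≤ β n)
    (hD : ∀ n, n - s n ≤ D) (hsq : Summable fun n => β n ^ 2) (hdiv : ¬ Summable β) :
    AdmissibleSteps β s := by
  refine ⟨hsq, hdiv, ?_⟩
  have hshift : ∀ j, Summable fun m => β (m + j) ^ 2 := fun j => (summable_nat_add_iff j).2 hsq
  rw [← summable_nat_add_iff D]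
  refine Summable.of_nonneg_of_le
    (fun m => mul_nonneg (hβ _) (Finset.sum_nonneg fun r _ => hβ r)) (fun m => ?_)
    (summable_sum (s := Finset.range D) fun j _ => (hshift D).add (hshift j))
  have hsub : Finset.Ico (s (m + D)) (m + D) ⊆ Finset.Ico m (m + D) :=
    Finset.Ico_subset_Ico_left (by have := hD (m + D); omega)
  calc β (m + D) * ∑ r ∈ Finset.Ico (s (m + D)) (m + D), β r
      ≤ β (m + D) * ∑ r ∈ Finset.Ico m (m + D), β r :=
        mul_le_mul_of_nonneg_left
          (Finset.sum_le_sum_of_subset_of_nonneg hsub fun r _ _ => hβ r) (hβ _)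
    _ = ∑ j ∈ Finset.range D, β (m + D) * β (m + j) := by
        rw [Finset.sum_Ico_eq_sum_range, Nat.add_sub_cancel_left, Finset.mul_sum]
    _ ≤ _ := Finset.sum_le_sum fun j _ => by
        nlinarith [sq_nonneg (β (m + D) - β (m + j)), sq_nonneg (β (m + D)), sq_nonneg (β (m + j))]

lemma admissibleSteps_of_sublinear_delay {β : ℕ → ℝ} {s : ℕ → ℕ} {K p : ℝ}
    (hβ : ∀ n, 0 ≤ β n) (hs : ∀ n, s n ≤ n) (hK : 0 < K) (hp0 : 0 < p) (hp1 : p < 1)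
    (hdel : ∀ n : ℕ, (n : ℝ) - s n ≤ K * (s n : ℝ) ^ p)
    (hval : ∀ n, β n = 1 / ((n : ℝ) + 1)) : AdmissibleSteps β s := by
  have ha0 : 0 < 1 - p := by linarith
  have hpot := summable_of_potential (β := β) (T := fun n => (n : ℝ) ^ (1 - p)) (s := s)
    (M := (1 - p)⁻¹) (c := (1 - p) * (K + 1)) (N := 1) hβ (inv_nonneg.2 ha0.le) (by positivity)
    (fun n hn => Real.rpow_pos_of_pos (by exact_mod_cast hn) _)
    (fun n _ => Real.rpow_le_rpow (Nat.cast_nonneg _) (by simp) ha0.le) ?_ hs ?_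
  · refine ⟨hpot.1, fun h => Real.not_summable_one_div_natCast ?_, hpot.2⟩
    rw [← summable_nat_add_iff 1]
    refine h.congr fun n => ?_
    rw [hval]
    push_cast
    rfl
  · intro n _
    have hn0 : (0 : ℝ) < n + 1 := by positivity
    have hpow : (0 : ℝ) < ((n : ℝ) + 1) ^ (1 - p) := Real.rpow_pos_of_pos hn0 _
    have hle1 : ((n : ℝ) + 1)⁻¹ ≤ 1 := inv_le_one_of_one_le₀ (by linarith [n.cast_nonneg (α := ℝ)])
    have hbern := rpow_one_add_le_one_add_mul_self (s := -((n : ℝ) + 1)⁻¹) (by linarith)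
      ha0.le (by linarith)
    have hsplit : (n : ℝ) ^ (1 - p) =
        ((n : ℝ) + 1) ^ (1 - p) * (1 + -((n : ℝ) + 1)⁻¹) ^ (1 - p) := by
      rw [← Real.mul_rpow hn0.le (by linarith)]
      congr 1
      field_simp
      ring
    push_cast
    rw [hval, ← div_eq_inv_mul, le_div_iff₀ ha0, le_div_iff₀ hpow, hsplit]
    have := mul_le_mul_of_nonneg_left hbern hpow.le
    rw [one_div]
    linarith
  · filter_upwards [(tendsto_atTop_of_delay_le_rpow hK.le hp0.le hdel).eventually_ge_atTop 1]
      with n hn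
    refine ⟨hn, ?_⟩
    have hm1 : (1 : ℝ) ≤ s n := by exact_mod_cast hn
    have hm0 : (0 : ℝ) < s n := by linarith
    have hsn : (s n : ℝ) ≤ n := by exact_mod_cast hs n
    have hquot : 0 ≤ ((n : ℝ) + 1 - s n) / s n := div_nonneg (by linarith) hm0.le
    have hbern := rpow_one_add_le_one_add_mul_self (s := ((n : ℝ) + 1 - s n) / s n) (by linarith)
      ha0.le (by linarith)
    have hsplit : ((n : ℝ) + 1) ^ (1 - p) =
        (s n : ℝ) ^ (1 - p) * (1 + ((n : ℝ) + 1 - s n) / s n) ^ (1 - p) := by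
      rw [← Real.mul_rpow hm0.le (by linarith)]
      congr 1
      field_simp
      ring
    have hpow : (0 : ℝ) < (s n : ℝ) ^ (1 - p) := Real.rpow_pos_of_pos hm0 _
    have hgap : (n : ℝ) + 1 - s n ≤ (K + 1) * (s n : ℝ) ^ p := by
      have := Real.one_le_rpow hm1 hp0.le
      linarith [hdel n]
    have hprod : (s n : ℝ) ^ (1 - p) * (((n : ℝ) + 1 - s n) / s n) ≤ K + 1 := by
      rw [← mul_div_assoc, div_le_iff₀ hm0]
      calc (s n : ℝ) ^ (1 - p) * ((n : ℝ) + 1 - s n)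
          ≤ (s n : ℝ) ^ (1 - p) * ((K + 1) * (s n : ℝ) ^ p) :=
            mul_le_mul_of_nonneg_left hgap hpow.le
        _ = (K + 1) * ((s n : ℝ) ^ (1 - p) * (s n : ℝ) ^ p) := by ring
        _ = _ := by rw [← Real.rpow_add hm0, sub_add_cancel, Real.rpow_one]
    push_cast
    rw [hsplit]
    have h1 := mul_le_mul_of_nonneg_left hbern hpow.le
    have h2 := mul_le_mul_of_nonneg_left hprod ha0.le
    linarith

/-- Steps of the form `w n / T (n + 1)`, where `w n` lies between two consecutive increments of the
potential `T`. -/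
lemma admissibleSteps_of_potential {β T w : ℕ → ℝ} {s : ℕ → ℕ} {c : ℝ} {N : ℕ}
    (hβ : ∀ n, 0 ≤ β n) (hs : ∀ n, s n ≤ n) (hc : 0 ≤ c)
    (hTpos : ∀ n, N ≤ n → 0 < T n) (hTmono : ∀ n, N ≤ n → T n ≤ T (n + 1))
    (hTlim : Filter.Tendsto T Filter.atTop Filter.atTop)
    (hval : ∀ n, N ≤ n → β n = w n / T (n + 1))
    (hw_le : ∀ n, N ≤ n → w n ≤ T (n + 1) - T n)
    (hw_ge : ∀ n, N ≤ n → T (n + 1 + 1) - T (n + 1) ≤ w n)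
    (hwin : ∀ᶠ n in Filter.atTop, N ≤ s n ∧ T (n + 1) ≤ T (s n) + c) :
    AdmissibleSteps β s := by
  have hpot := summable_of_potential (M := 1) hβ zero_le_one hc hTpos hTmono
    (fun n hn => by
      rw [one_mul, hval n hn]
      exact div_le_div_of_nonneg_right (hw_le n hn) (hTpos _ (by omega)).le) hs hwin
  refine ⟨hpot.1, ?_, hpot.2⟩
  refine not_summable_of_sub_le (u := fun n => Real.log (T (n + 1))) hβ N
    (Real.tendsto_log_atTop.comp (hTlim.comp (Filter.tendsto_add_atTop_nat 1))) fun n hn => ?_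
  have h1 := hTpos (n + 1) (by omega)
  refine (log_sub_log_le_sub_div h1 (hTpos (n + 1 + 1) (by omega))).trans ?_
  rw [hval n hn]
  exact div_le_div_of_nonneg_right (hw_ge n hn) h1.le

lemma log_succ_sub_log_le {n : ℕ} (hn : 1 ≤ n) :
    Real.log ((n + 1 : ℕ) : ℝ) - Real.log n ≤ 1 / n := by
  have hn' : (0 : ℝ) < n := by exact_mod_cast hn
  simpa using log_sub_log_le_sub_div hn' (b := ((n + 1 : ℕ) : ℝ)) (by positivity)

lemma le_log_succ_sub_log {n : ℕ} (hn : 1 ≤ n) :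
    1 / ((n + 1 : ℕ) : ℝ) ≤ Real.log ((n + 1 : ℕ) : ℝ) - Real.log n := by
  have hn' : (0 : ℝ) < n := by exact_mod_cast hn
  simpa using sub_div_le_log_sub_log hn' (b := ((n + 1 : ℕ) : ℝ)) (by positivity)

lemma log_succ_le_of_delay_le_rpow {n m : ℕ} {K q : ℝ} (hK : 0 ≤ K) (hq : 1 ≤ q) (hm : 1 ≤ m)
    (h : (n : ℝ) - m ≤ K * (m : ℝ) ^ q) :
    Real.log ((n + 1 : ℕ) : ℝ) ≤ Real.log (K + 2) + q * Real.log m := by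
  have hm' : (0 : ℝ) < m := by exact_mod_cast hm
  rw [← Real.log_rpow hm', ← Real.log_mul (by linarith) (Real.rpow_pos_of_pos hm' q).ne']
  refine Real.log_le_log (by positivity) ?_
  push_cast
  exact succ_le_of_delay_le_rpow hq hm h

lemma admissibleSteps_of_linear_delay {β : ℕ → ℝ} {s : ℕ → ℕ} {K : ℝ}
    (hβ : ∀ n, 0 ≤ β n) (hs : ∀ n, s n ≤ n) (hK : 0 < K)
    (hdel : ∀ n : ℕ, (n : ℝ) - s n ≤ K * s n)
    (hval : ∀ n, 2 ≤ n → β n = 1 / (((n + 1 : ℕ) : ℝ) * Real.log ((n + 1 : ℕ) : ℝ))) :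
    AdmissibleSteps β s := by
  have hdel' : ∀ n : ℕ, (n : ℝ) - s n ≤ K * (s n : ℝ) ^ (1 : ℝ) := by simpa using hdel
  refine admissibleSteps_of_potential (T := fun n => Real.log n)
    (w := fun n => 1 / ((n + 1 : ℕ) : ℝ)) (c := Real.log (K + 2)) (N := 2) hβ hs
    (Real.log_nonneg (by linarith)) (fun n hn => Real.log_pos (by exact_mod_cast hn))
    (fun n hn => Real.log_le_log (by positivity) (by simp))
    (Real.tendsto_log_atTop.comp tendsto_natCast_atTop_atTop)
    (fun n hn => by rw [hval n hn, div_div])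
    (fun n hn => le_log_succ_sub_log (by omega))
    (fun n hn => log_succ_sub_log_le (by omega)) ?_
  filter_upwards [(tendsto_atTop_of_delay_le_rpow hK.le zero_le_one hdel').eventually_ge_atTop 2]
    with n hn
  have := log_succ_le_of_delay_le_rpow hK.le le_rfl (by omega) (hdel' n)
  exact ⟨hn, by linarith⟩

lemma one_lt_log_natCast {n : ℕ} (hn : 3 ≤ n) : 1 < Real.log n := by
  rw [Real.lt_log_iff_exp_lt (by positivity)]
  exact Real.exp_one_lt_three.trans_le (by exact_mod_cast hn)

lemma admissibleSteps_of_polynomial_delay {β : ℕ → ℝ} {s : ℕ → ℕ} {K q : ℝ}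
    (hβ : ∀ n, 0 ≤ β n) (hs : ∀ n, s n ≤ n) (hK : 0 < K) (hq : 1 ≤ q)
    (hdel : ∀ n : ℕ, (n : ℝ) - s n ≤ K * (s n : ℝ) ^ q)
    (hval : ∀ n, 3 ≤ n → β n = 1 / (((n + 1 : ℕ) : ℝ) * Real.log ((n + 1 : ℕ) : ℝ) *
      Real.log (Real.log ((n + 1 : ℕ) : ℝ)))) :
    AdmissibleSteps β s := by
  have hlogpos : ∀ n : ℕ, 3 ≤ n → 0 < Real.log n := fun n hn =>
    zero_lt_one.trans (one_lt_log_natCast hn)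
  have hlogK : 0 ≤ Real.log (K + 2) := Real.log_nonneg (by linarith)
  refine admissibleSteps_of_potential (T := fun n => Real.log (Real.log n))
    (w := fun n => 1 / (((n + 1 : ℕ) : ℝ) * Real.log ((n + 1 : ℕ) : ℝ)))
    (c := Real.log (Real.log (K + 2) + q)) (N := 3) hβ hs
    (Real.log_nonneg (by linarith)) (fun n hn => Real.log_pos (one_lt_log_natCast hn))
    (fun n hn => Real.log_le_log (hlogpos n hn) (Real.log_le_log (by positivity) (by simp)))
    (Real.tendsto_log_atTop.comp (Real.tendsto_log_atTop.comp tendsto_natCast_atTop_atTop))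
    (fun n hn => by rw [hval n hn, div_div]) (fun n hn => ?_) (fun n hn => ?_) ?_
  · have h1 := hlogpos (n + 1) (by omega)
    refine le_trans ?_ (sub_div_le_log_sub_log (hlogpos n hn) h1)
    rw [← div_div]
    exact div_le_div_of_nonneg_right (le_log_succ_sub_log (by omega)) h1.le
  · have h1 := hlogpos (n + 1) (by omega)
    refine (log_sub_log_le_sub_div h1 (hlogpos (n + 1 + 1) (by omega))).trans ?_
    rw [← div_div]
    exact div_le_div_of_nonneg_right (log_succ_sub_log_le (by omega)) h1.le
  · filter_upwards [(tendsto_atTop_of_delay_le_rpow hK.le (by linarith)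
      hdel).eventually_ge_atTop 3] with n hn
    refine ⟨hn, ?_⟩
    have h1 := one_lt_log_natCast hn
    have h2 := log_succ_le_of_delay_le_rpow hK.le hq (by omega) (hdel n)
    have h3 := hlogpos (n + 1) (by have := hs n; omega)
    rw [add_comm (Real.log _), ← Real.log_mul (by linarith) (by linarith)]
    refine Real.log_le_log h3 (h2.trans ?_)
    nlinarith

lemma DelayStep.admissibleSteps {s : ℕ → ℕ} {α : ℕ → ℝ} (h : DelayStep s α)
    (hα : ∀ n, 0 < α n) (hs : ∀ n, s n ≤ n) : AdmissibleSteps (fun n => α (n + 1)) s := by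
  have hβ : ∀ n, 0 ≤ α (n + 1) := fun n => (hα _).le
  rcases h with ⟨D, hD, hsq, hdiv⟩ | ⟨K, hK, p, hp0, hp1, hdel, hval⟩ | ⟨K, hK, hdel, hval⟩ |
    ⟨K, hK, q, hq, hdel, hval⟩
  · exact admissibleSteps_of_bounded_delay hβ hD ((summable_nat_add_iff 1).2 hsq)
      fun h => hdiv ((summable_nat_add_iff 1).1 h)
  · exact admissibleSteps_of_sublinear_delay hβ hs hK hp0 hp1 hdel fun n => by
      rw [hval _ (by omega)]
      push_cast
      rfl
  · exact admissibleSteps_of_linear_delay hβ hs hK hdel fun n hn => hval _ (by omega)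
  · exact admissibleSteps_of_polynomial_delay hβ hs hK hq hdel fun n hn => hval _ (by omega)

/-! ### Geometry of the projection and of the energy -/

section Projection

variable {F : Type*} [NormedAddCommGroup F] [InnerProductSpace ℝ F]

lemma inner_sub_le_zero_of_norm_le {X : Set F} (hX : Convex ℝ X) {y v : F} (hv : v ∈ X)
    (hmin : ∀ x ∈ X, ‖y - v‖ ≤ ‖y - x‖) {w : F} (hw : w ∈ X) : ⟪y - v, w - v⟫ ≤ 0 := by
  have : Nonempty X := ⟨⟨v, hv⟩⟩
  refine (norm_eq_iInf_iff_real_inner_le_zero hX hv).1 (le_antisymm ?_ ?_) w hw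
  · exact le_ciInf fun x => hmin x x.2
  · exact ciInf_le ⟨0, by rintro _ ⟨x, rfl⟩; exact norm_nonneg _⟩ (⟨v, hv⟩ : X)

lemma norm_sub_le_of_inner_le_zero {y y' p p' : F} (h : ⟪y - p, p' - p⟫ ≤ 0)
    (h' : ⟪y' - p', p - p'⟫ ≤ 0) : ‖p' - p‖ ≤ ‖y' - y‖ := by
  have hsq : ‖p' - p‖ ^ 2 ≤ ⟪y' - y, p' - p⟫ := by
    rw [← real_inner_self_eq_norm_sq]
    simp only [inner_sub_left, inner_sub_right] at h h' ⊢
    linarith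
  have hcs := real_inner_le_norm (y' - y) (p' - p)
  nlinarith [norm_nonneg (p' - p), norm_nonneg (y' - y)]

end Projection

section Energy

variable {d : ℕ} {proj : EuclideanSpace ℝ (Fin d) → EuclideanSpace ℝ (Fin d)}

lemma Eaux_eq_norm_sq_sub (z y : EuclideanSpace ℝ (Fin d)) :
    Eaux proj z y = ‖y - z‖ ^ 2 - ‖y - proj y‖ ^ 2 := by
  rw [Eaux, norm_sub_sq_real, norm_sub_sq_real, inner_sub_right]
  ring

lemma Eaux_nonneg {z y : EuclideanSpace ℝ (Fin d)} (h : ‖y - proj y‖ ≤ ‖y - z‖) :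
    0 ≤ Eaux proj z y := by
  rw [Eaux_eq_norm_sq_sub, sub_nonneg]
  exact pow_le_pow_left₀ (norm_nonneg _) h 2

/-- One-step descent estimate for the energy. -/
lemma Eaux_add_le {z y δ : EuclideanSpace ℝ (Fin d)}
    (h : ⟪y - proj y, proj (y + δ) - proj y⟫ ≤ 0) :
    Eaux proj z (y + δ) ≤ Eaux proj z y + 2 * ⟪δ, proj y - z⟫ + ‖δ‖ ^ 2 := by
  have hsq := sq_nonneg ‖δ - (proj (y + δ) - proj y)‖
  simp only [Eaux, ← real_inner_self_eq_norm_sq, inner_sub_left, inner_sub_right,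
    inner_add_left] at h hsq ⊢
  have h1 := real_inner_comm (proj y) (proj (y + δ))
  have h2 := real_inner_comm δ (proj (y + δ))
  have h3 := real_inner_comm δ (proj y)
  linarith

end Energy

lemma tendsto_infDist_of_tendsto_zero {E : Type*} [MetricSpace E] {X S : Set E}
    (hX : IsCompact X) {g : E → ℝ} (hg : Continuous g) (hg0 : ∀ z ∈ X, 0 ≤ g z)
    (hgS : ∀ z ∈ X, g z = 0 → z ∈ S) {x : ℕ → E} (hx : ∀ n, x n ∈ X)
    (hlim : Filter.Tendsto (fun n => g (x n)) Filter.atTop (nhds 0)) :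
    Filter.Tendsto (fun n => Metric.infDist (x n) S) Filter.atTop (nhds 0) := by
  refine Metric.tendsto_atTop'.2 fun ε hε => ?_
  have hcomp : IsCompact (X ∩ {z | ε ≤ Metric.infDist z S}) :=
    hX.inter_right (isClosed_le continuous_const (Metric.continuous_infDist_pt S))
  have hfar : ∃ c > 0, ∀ z ∈ X, ε ≤ Metric.infDist z S → c ≤ g z := by
    rcases (X ∩ {z | ε ≤ Metric.infDist z S}).eq_empty_or_nonempty with he | hne
    · exact ⟨1, one_pos, fun z hz hz' => (Set.eq_empty_iff_forall_notMem.1 he z ⟨hz, hz'⟩).elim⟩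
    · obtain ⟨m, hm, hmin⟩ := hcomp.exists_isMinOn hne hg.continuousOn
      refine ⟨g m, (hg0 m hm.1).lt_of_ne fun h0 => ?_, fun z hz hz' => hmin ⟨hz, hz'⟩⟩
      have := hm.2
      rw [Set.mem_ofPred_eq, Metric.infDist_zero_of_mem (hgS m hm.1 h0.symm)] at this
      exact this.not_gt hε
  obtain ⟨c, hc, hfar⟩ := hfar
  obtain ⟨N, hN⟩ := Filter.eventually_atTop.1 (hlim.eventually (gt_mem_nhds hc))
  refine ⟨N, fun n hn => ?_⟩
  rw [Real.dist_0_eq_abs, abs_of_nonneg Metric.infDist_nonneg]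
  by_contra! hge
  exact (hfar _ (hx n) hge).not_gt (hN n hn.le)

/-- **Theorem (global convergence of DAGD).** Under the constrained deterministic
setup with variational coherence, reciprocity and the delay/step-size assumption,
the DAGD state variable `xₙ` converges to the solution set `𝒳*`. -/
theorem dagd_converges
    {d : ℕ} (Xset : Set (EuclideanSpace ℝ (Fin d)))
    (hXc : IsCompact Xset) (hXconv : Convex ℝ Xset) (hXne : Xset.Nonempty)
    (proj : EuclideanSpace ℝ (Fin d) → EuclideanSpace ℝ (Fin d))
    (hprojmem : ∀ y, proj y ∈ Xset)
    (hprojmin : ∀ y, ∀ x ∈ Xset, ‖y - proj y‖ ≤ ‖y - x‖)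
    (f : EuclideanSpace ℝ (Fin d) → ℝ)
    (gradf : EuclideanSpace ℝ (Fin d) → EuclideanSpace ℝ (Fin d))
    (hgrad : ∀ x, HasGradientAt f (gradf x) x)
    (L : NNReal) (hLip : LipschitzWith L gradf)
    (Xstar : Set (EuclideanSpace ℝ (Fin d)))
    (hXstar : Xstar = {x | x ∈ Xset ∧ ∀ z ∈ Xset, f x ≤ f z})
    (hstarne : Xstar.Nonempty)
    (hVC : ∀ x ∈ Xset, ∀ xstar ∈ Xstar,
      0 ≤ ⟪gradf x, x - xstar⟫ ∧ (⟪gradf x, x - xstar⟫ = 0 → x ∈ Xstar))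
    (hrecip : ∀ y : ℕ → EuclideanSpace ℝ (Fin d),
      Filter.Tendsto (fun n => energy proj Xstar (y n)) Filter.atTop (nhds 0) →
      Filter.Tendsto (fun n => Metric.infDist (proj (y n)) Xstar) Filter.atTop (nhds 0))
    (α : ℕ → ℝ) (hα : ∀ n, 0 < α n)
    (s : ℕ → ℕ) (hs : ∀ n, s n ≤ n)
    (hdelay : DelayStep s α)
    (x y : ℕ → EuclideanSpace ℝ (Fin d))
    (hxy : ∀ n, x n = proj (y n))
    (hrec : ∀ n, y (n + 1) = y n - α (n + 1) • gradf (x (s n))) :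
    Filter.Tendsto (fun n => Metric.infDist (x n) Xstar) Filter.atTop (nhds 0) := by
  obtain ⟨hsq, hdiv, herr⟩ := hdelay.admissibleSteps hα hs
  obtain ⟨z, hz⟩ := hstarne
  have hzX : z ∈ Xset := by
    rw [hXstar] at hz
    exact hz.1
  have hxX : ∀ n, x n ∈ Xset := fun n => hxy n ▸ hprojmem _
  have hangle : ∀ y y', ⟪y - proj y, proj y' - proj y⟫ ≤ 0 := fun y y' =>
    inner_sub_le_zero_of_norm_le hXconv (hprojmem y) (hprojmin y) (hprojmem y')
  have hβ : ∀ n, 0 ≤ α (n + 1) := fun n => (hα _).le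
  obtain ⟨G, hG⟩ := hXc.exists_bound_of_continuousOn hLip.continuous.continuousOn
  obtain ⟨R, hR⟩ := hXc.exists_bound_of_continuousOn
    (f := fun u => u - z) (continuous_id.sub continuous_const).continuousOn
  have hG0 : 0 ≤ G := (norm_nonneg _).trans (hG z hzX)
  have hR0 : 0 ≤ R := (norm_nonneg _).trans (hR z hzX)
  have hstep : ∀ n, ‖x (n + 1) - x n‖ ≤ G * α (n + 1) := by
    intro n
    rw [hxy, hxy]
    refine (norm_sub_le_of_inner_le_zero (hangle _ _) (hangle _ _)).trans ?_
    rw [hrec n, sub_sub_cancel_left, norm_neg, norm_smul, Real.norm_of_nonneg (hβ n), mul_comm]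
    exact mul_le_mul_of_nonneg_right (hG _ (hxX _)) (hβ n)
  have hlag : ∀ n, ‖x (s n) - x n‖ ≤ G * ∑ r ∈ Finset.Ico (s n) n, α (r + 1) := by
    intro n
    rw [← dist_eq_norm, Finset.mul_sum]
    refine dist_le_Ico_sum_of_dist_le (hs n) fun {k} _ _ => ?_
    rw [dist_comm, dist_eq_norm]
    exact hstep k
  have hgradlip : ∀ u v, ‖gradf u - gradf v‖ ≤ L * ‖u - v‖ := fun u v => by
    simpa [dist_eq_norm] using hLip.dist_le_mul u v
  set φ : ℕ → ℝ := fun n => ⟪gradf (x n), x n - z⟫ with hφdef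
  have hφ0 : ∀ n, 0 ≤ φ n := fun n => (hVC _ (hxX n) z hz).1
  have hdescent : ∀ n, 2 * (α (n + 1) * φ n) ≤ Eaux proj z (y n) - Eaux proj z (y (n + 1)) +
      (2 * (L * G * R) * (α (n + 1) * ∑ r ∈ Finset.Ico (s n) n, α (r + 1)) +
        G ^ 2 * α (n + 1) ^ 2) := by
    intro n
    have hE := Eaux_add_le (z := z) (hangle (y n) (y n + -(α (n + 1) • gradf (x (s n)))))
    rw [← sub_eq_add_neg, ← hrec n, ← hxy n, norm_neg, inner_neg_left, real_inner_smul_left,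
      norm_smul, Real.norm_of_nonneg (hβ n), mul_pow] at hE
    have hdrift : φ n - ⟪gradf (x (s n)), x n - z⟫ ≤
        L * G * R * ∑ r ∈ Finset.Ico (s n) n, α (r + 1) := by
      rw [hφdef, ← inner_sub_left]
      refine (real_inner_le_norm _ _).trans ?_
      rw [norm_sub_rev (gradf (x n))]
      calc ‖gradf (x (s n)) - gradf (x n)‖ * ‖x n - z‖
          ≤ (L * (G * ∑ r ∈ Finset.Ico (s n) n, α (r + 1))) * R :=
            mul_le_mul ((hgradlip _ _).trans (mul_le_mul_of_nonneg_left (hlag n) L.2))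
              (hR _ (hxX n)) (norm_nonneg _)
              (mul_nonneg L.2 ((norm_nonneg _).trans (hlag n)))
        _ = _ := by ring
    have h1 := mul_le_mul_of_nonneg_left hdrift (hβ n)
    have h2 : ‖gradf (x (s n))‖ ^ 2 ≤ G ^ 2 :=
      pow_le_pow_left₀ (norm_nonneg _) (hG _ (hxX _)) 2
    have h3 := mul_le_mul_of_nonneg_left h2 (sq_nonneg (α (n + 1)))
    linarith
  have herr' : Summable fun n => 2 * (L * G * R) *
      (α (n + 1) * ∑ r ∈ Finset.Ico (s n) n, α (r + 1)) + G ^ 2 * α (n + 1) ^ 2 :=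
    (herr.mul_left _).add (hsq.mul_left _)
  have hsum : Summable fun n => α (n + 1) * φ n := by
    rw [← summable_mul_left_iff (two_ne_zero (α := ℝ))]
    refine summable_of_sum_range_le (c := Eaux proj z (y 0) + ∑' n, (2 * (L * G * R) *
      (α (n + 1) * ∑ r ∈ Finset.Ico (s n) n, α (r + 1)) + G ^ 2 * α (n + 1) ^ 2))
      (fun n => mul_nonneg zero_le_two (mul_nonneg (hβ n) (hφ0 n))) fun n =>
      (Finset.sum_le_sum fun i _ => hdescent i).trans ?_
    rw [Finset.sum_add_distrib, Finset.sum_range_sub' fun i => Eaux proj z (y i)]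
    have h1 := Eaux_nonneg (hprojmin (y n) z hzX)
    refine add_le_add (sub_le_self _ h1) (herr'.sum_le_tsum _ fun i _ => ?_)
    have := Finset.sum_nonneg fun r (_ : r ∈ Finset.Ico (s i) i) => hβ r
    have := hβ i
    positivity
  have hinc : ∀ n, |φ (n + 1) - φ n| ≤ (L * R + G) * G * α (n + 1) := by
    intro n
    have hsplit : φ (n + 1) - φ n = ⟪gradf (x (n + 1)) - gradf (x n), x (n + 1) - z⟫ +
        ⟪gradf (x n), x (n + 1) - x n⟫ := by
      simp only [hφdef, inner_sub_left, inner_sub_right]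
      ring
    rw [hsplit]
    calc _ ≤ ‖gradf (x (n + 1)) - gradf (x n)‖ * ‖x (n + 1) - z‖ +
          ‖gradf (x n)‖ * ‖x (n + 1) - x n‖ :=
          (abs_add_le _ _).trans
            (add_le_add (abs_real_inner_le_norm _ _) (abs_real_inner_le_norm _ _))
      _ ≤ (L * (G * α (n + 1))) * R + G * (G * α (n + 1)) := by
          refine add_le_add (mul_le_mul ?_ (hR _ (hxX _)) (norm_nonneg _) ?_)
            (mul_le_mul (hG _ (hxX n)) (hstep n) (norm_nonneg _) hG0)
          · exact (hgradlip _ _).trans (mul_le_mul_of_nonneg_left (hstep n) L.2)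
          · exact mul_nonneg L.2 (mul_nonneg hG0 (hβ n))
      _ = _ := by ring
  exact tendsto_infDist_of_tendsto_zero hXc (g := fun u => ⟪gradf u, u - z⟫)
    (hLip.continuous.inner (continuous_id.sub continuous_const))
    (fun u hu => (hVC u hu z hz).1) (fun u hu => (hVC u hu z hz).2) hxX
    (tendsto_zero_of_summable_mul hβ hφ0 hsq hdiv hsum hinc)

end
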